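/- Let p be an odd prime, k₁, k₂ ∈ ℕ, and α ∈ ℤ. Then ω_{p^{k₁},p^{k₂}}(α, 0) = p^{k₁+2k₂}·φ(p^{k₁}) if p^{k₁+2k₂} | α and k₁ is even, and ω_{p^{k₁},p^{k₂}}(α, 0) = 0 otherwise. -/

import Mathlib

/-- `e(t) = e^{2πit}`. -/
noncomputable def e2 (t : ℝ) : ℂ := Complex.exp (2 * Real.pi * Complex.I * t)

/-- The character sum
`ω_{p^{k₁},p^{k₂}}(α, β) = ∑_{a, b mod p^{k₁+2k₂}, a² ≡ b (p^{2k₂})}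
(((a²−b)/p^{2k₂}) | p^{k₁}) · e((2aα + bβ)/p^{k₁+2k₂})`. -/
noncomputable def omegaSum (p k₁ k₂ : ℕ) (α β : ℤ) : ℂ :=
  ∑ a ∈ Finset.range (p ^ (k₁ + 2 * k₂)), ∑ b ∈ Finset.range (p ^ (k₁ + 2 * k₂)),
    if (p : ℤ) ^ (2 * k₂) ∣ ((a : ℤ) ^ 2 - (b : ℤ)) then
      ((jacobiSym (((a : ℤ) ^ 2 - (b : ℤ)) / (p : ℤ) ^ (2 * k₂)) (p ^ k₁) : ℤ) : ℂ) *
        e2 (((2 * a * α + b * β : ℤ) : ℝ) / (p : ℝ) ^ (k₁ + 2 * k₂))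
    else 0

lemma aux_range_zmod (n : ℕ) [NeZero n] (G : ZMod n → ℂ) :
    ∑ b ∈ Finset.range n, G ((b : ℕ) : ZMod n) = ∑ z : ZMod n, G z := by
  refine Finset.sum_bij (fun b _ => (b : ZMod n)) (by simp) ?_ ?_ (by simp)
  · intro a ha b hb h
    have := (ZMod.natCast_eq_natCast_iff' a b n).1 h
    rwa [Nat.mod_eq_of_lt (Finset.mem_range.1 ha), Nat.mod_eq_of_lt (Finset.mem_range.1 hb)] at this
  · intro z _
    exact ⟨z.val, Finset.mem_range.2 (ZMod.val_lt z), by simp⟩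

lemma aux_lift (n : ℕ) [NeZero n] (g : ℤ → ℂ) (hg : ∀ x y : ℤ, (n : ℤ) ∣ x - y → g x = g y) :
    ∃ G : ZMod n → ℂ, ∀ x : ℤ, G (x : ZMod n) = g x := by
  refine ⟨fun z => g (z.val : ℤ), fun x => hg _ _ ?_⟩
  rw [← ZMod.intCast_zmod_eq_zero_iff_dvd]
  simp

lemma aux_sub (n : ℕ) [NeZero n] (g : ℤ → ℂ) (hg : ∀ x y : ℤ, (n : ℤ) ∣ x - y → g x = g y)
    (A : ℤ) : ∑ b ∈ Finset.range n, g (A - (b : ℤ)) = ∑ b ∈ Finset.range n, g (b : ℤ) := by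
  obtain ⟨G, hG⟩ := aux_lift n g hg
  have h1 := aux_range_zmod n (fun z => G ((A : ZMod n) - z))
  have h2 := aux_range_zmod n G
  have h3 : ∑ z : ZMod n, G ((A : ZMod n) - z) = ∑ z, G z :=
    Equiv.sum_comp (Equiv.subLeft (A : ZMod n)) G
  rw [h3, ← h2] at h1
  simp only [← hG]
  push_cast
  exact h1

lemma aux_mul (n : ℕ) [NeZero n] (g : ℤ → ℂ) (hg : ∀ x y : ℤ, (n : ℤ) ∣ x - y → g x = g y)
    (u : ℤ) (hu : IsUnit (u : ZMod n)) :
    ∑ b ∈ Finset.range n, g (u * (b : ℤ)) = ∑ b ∈ Finset.range n, g (b : ℤ) := by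
  obtain ⟨G, hG⟩ := aux_lift n g hg
  obtain ⟨v, hv⟩ := hu
  have h1 := aux_range_zmod n (fun z => G ((u : ZMod n) * z))
  have h2 := aux_range_zmod n G
  have h3 : ∑ z : ZMod n, G ((u : ZMod n) * z) = ∑ z, G z := by
    rw [← hv]
    exact Equiv.sum_comp (Units.mulLeft v) G
  rw [h3, ← h2] at h1
  simp only [← hG]
  push_cast
  exact h1

lemma aux_inner (N M : ℕ) (hN : 0 < N) (hM : 0 < M) (f : ℤ → ℂ)
    (hf : ∀ x y : ℤ, (N : ℤ) ∣ x - y → f x = f y) (A : ℤ) :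
    ∑ b ∈ Finset.range (N * M), (if (M : ℤ) ∣ A - (b : ℤ) then f ((A - (b : ℤ)) / (M : ℤ)) else 0)
      = ∑ c ∈ Finset.range N, f (c : ℤ) := by
  have : NeZero (N * M) := ⟨(Nat.mul_pos hN hM).ne'⟩
  have hM0 : (M : ℤ) ≠ 0 := by exact_mod_cast hM.ne'
  rw [aux_sub (N * M) (fun x => if (M : ℤ) ∣ x then f (x / (M : ℤ)) else 0) ?_ A]
  · rw [← Finset.sum_filter]
    symm
    refine Finset.sum_bij (fun c _ => c * M) ?_ ?_ ?_ ?_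
    · intro c hc
      simp only [Finset.mem_filter, Finset.mem_range] at *
      exact ⟨Nat.mul_lt_mul_of_pos_right hc hM, by push_cast; exact dvd_mul_left _ _⟩
    · intro a _ b _ h
      exact Nat.eq_of_mul_eq_mul_right hM h
    · intro b hb
      simp only [Finset.mem_filter, Finset.mem_range] at hb
      obtain ⟨h1, h2⟩ := hb
      obtain ⟨c, rfl⟩ := Int.natCast_dvd_natCast.1 h2
      refine ⟨c, Finset.mem_range.2 ?_, mul_comm _ _⟩
      rw [mul_comm] at h1
      exact Nat.lt_of_mul_lt_mul_right h1
    · intro c _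
      push_cast
      rw [Int.mul_ediv_cancel _ hM0]
  · rintro x y ⟨k, hk⟩
    have hx : x = y + M * (N * k) := by push_cast at hk; linarith
    subst hx
    have : (M : ℤ) ∣ y + M * (N * k) ↔ (M : ℤ) ∣ y := by simp
    by_cases h : (M : ℤ) ∣ y
    · simp only [this, h, if_true]
      obtain ⟨d, rfl⟩ := h
      rw [← mul_add, Int.mul_ediv_cancel_left _ hM0, Int.mul_ediv_cancel_left _ hM0]
      exact hf _ _ ⟨k, by ring⟩
    · simp only [this, h, if_false]

lemma aux_per (n : ℕ) (x y : ℤ) (h : (n : ℤ) ∣ x - y) :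
    ((jacobiSym x n : ℤ) : ℂ) = ((jacobiSym y n : ℤ) : ℂ) := by
  rw [jacobiSym.mod_left' (Int.emod_eq_emod_iff_emod_sub_eq_zero.2 (Int.emod_eq_zero_of_dvd h))]

lemma aux_jac (p : ℕ) (hp : p.Prime) (hodd : Odd p) (k : ℕ) :
    ∑ c ∈ Finset.range (p ^ k), ((jacobiSym (c : ℤ) (p ^ k) : ℤ) : ℂ) =
      if Even k then (Nat.totient (p ^ k) : ℂ) else 0 := by
  have := Fact.mk hp
  have : NeZero (p ^ k) := ⟨pow_ne_zero _ hp.ne_zero⟩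
  split_ifs with hk
  · rw [Nat.totient_eq_card_coprime, Finset.card_filter]
    push_cast
    refine Finset.sum_congr rfl fun c _ => ?_
    obtain ⟨m, rfl⟩ := hk
    split_ifs with hc
    · have h1 : jacobiSym (c : ℤ) (p ^ m) ^ 2 = 1 := by
        apply jacobiSym.sq_one
        rw [pow_add] at hc
        have := Nat.Coprime.coprime_mul_right hc
        simpa [Int.gcd] using this.symm
      rw [pow_add, jacobiSym.mul_right, ← sq, h1]; simp
    · have : jacobiSym (c : ℤ) (p ^ (m + m)) = 0 := by
        rw [jacobiSym.eq_zero_iff_not_coprime]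
        intro h; apply hc
        simpa [Int.gcd] using Nat.Coprime.symm h
      simp [this]
  · obtain ⟨u, hu⟩ : ∃ u : ℤ, jacobiSym u p = -1 := by
      obtain ⟨a, ha⟩ := FiniteField.exists_nonsquare (F := ZMod p)
        (by rw [ZMod.ringChar_zmod_n]; rintro rfl; revert hodd; decide)
      refine ⟨(a.val : ℤ), ?_⟩
      rw [← jacobiSym.legendreSym.to_jacobiSym, legendreSym.eq_neg_one_iff]
      simpa using ha
    have hu' : jacobiSym u (p ^ k) = -1 := by
      rw [jacobiSym.pow_right, hu, Odd.neg_one_pow (Nat.not_even_iff_odd.1 hk)]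
    have hunit : IsUnit (u : ZMod (p ^ k)) := by
      rw [ZMod.coe_int_isUnit_iff_isCoprime, isCoprime_comm, Int.isCoprime_iff_gcd_eq_one]
      by_contra h
      rw [jacobiSym.eq_zero_iff_not_coprime.2 h] at hu'
      norm_num at hu'
    have := aux_mul (p ^ k) (fun x => ((jacobiSym x (p ^ k) : ℤ) : ℂ)) (aux_per _) u hunit
    simp only [jacobiSym.mul_left, hu'] at this
    push_cast at this
    rw [← Finset.mul_sum] at this
    linear_combination (-1/2 : ℂ) * this

lemma aux_exp (n : ℕ) (hn : 0 < n) (β : ℤ) :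
    ∑ a ∈ Finset.range n, e2 (((a * β : ℤ) : ℝ) / (n : ℝ)) = if (n : ℤ) ∣ β then (n : ℂ) else 0 := by
  have hn0 : (n : ℂ) ≠ 0 := by exact_mod_cast hn.ne'
  set z : ℂ := Complex.exp (2 * Real.pi * Complex.I * (β / n)) with hz
  have h1 : ∀ a : ℕ, e2 (((a * β : ℤ) : ℝ) / (n : ℝ)) = z ^ a := by
    intro a
    rw [e2, hz, ← Complex.exp_nat_mul]
    congr 1; push_cast; ring
  simp only [h1]
  have hzn : z ^ n = 1 := by
    rw [hz, ← Complex.exp_nat_mul, Complex.exp_eq_one_iff]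
    exact ⟨β, by field_simp⟩
  have hz1 : z = 1 ↔ (n : ℤ) ∣ β := by
    rw [hz, Complex.exp_eq_one_iff]
    constructor
    · rintro ⟨m, hm⟩
      have h2 := Complex.two_pi_I_ne_zero
      rw [mul_comm (m : ℂ)] at hm
      have h3 := mul_left_cancel₀ h2 hm
      rw [div_eq_iff hn0] at h3
      exact ⟨m, by rw [mul_comm]; exact_mod_cast h3⟩
    · rintro ⟨m, rfl⟩
      exact ⟨m, by push_cast; field_simp⟩
  split_ifs with h
  · simp [hz1.2 h]
  · have h2 := mul_geom_sum z n
    rw [hzn, sub_self] at h2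
    exact (mul_eq_zero.1 h2).resolve_left (sub_ne_zero.2 fun h' => h (hz1.1 h'))

/-- For an odd prime `p`, `ω_{p^{k₁},p^{k₂}}(α, 0) = p^{k₁+2k₂}·φ(p^{k₁})` if
`p^{k₁+2k₂} ∣ α` and `k₁` is even, and `= 0` otherwise. -/
theorem omegaSum_beta_zero (p : ℕ) (hp : p.Prime) (hodd : Odd p) (k₁ k₂ : ℕ)
    (α : ℤ) :
    omegaSum p k₁ k₂ α 0 =
      if (p : ℤ) ^ (k₁ + 2 * k₂) ∣ α ∧ Even k₁ then
        ((p : ℂ) ^ (k₁ + 2 * k₂)) * (Nat.totient (p ^ k₁) : ℂ)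
      else 0 := by
  have key : ∀ a : ℕ, (∑ b ∈ Finset.range (p ^ (k₁ + 2 * k₂)),
    if (p : ℤ) ^ (2 * k₂) ∣ ((a : ℤ) ^ 2 - (b : ℤ)) then
      ((jacobiSym (((a : ℤ) ^ 2 - (b : ℤ)) / (p : ℤ) ^ (2 * k₂)) (p ^ k₁) : ℤ) : ℂ) *
        e2 (((2 * a * α + b * 0 : ℤ) : ℝ) / (p : ℝ) ^ (k₁ + 2 * k₂))
    else 0) = (if Even k₁ then (Nat.totient (p ^ k₁) : ℂ) else 0) *
      e2 (((a * (2 * α) : ℤ) : ℝ) / ((p ^ (k₁ + 2 * k₂) : ℕ) : ℝ)) := by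
    intro a
    rw [← aux_jac p hp hodd k₁, ← aux_inner (p ^ k₁) (p ^ (2 * k₂)) (pow_pos hp.pos _)
      (pow_pos hp.pos _) (fun x => ((jacobiSym x (p ^ k₁) : ℤ) : ℂ)) (aux_per _) ((a : ℤ) ^ 2),
      Finset.sum_mul, ← pow_add]
    refine Finset.sum_congr rfl fun b _ => ?_
    rw [ite_mul, zero_mul]
    push_cast
    have : (2 * (a : ℝ) * α + b * 0) = a * (2 * α) := by ring
    rw [this]
  rw [omegaSum, Finset.sum_congr rfl fun a _ => key a, ← Finset.mul_sum,
    aux_exp _ (pow_pos hp.pos _)]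
  have h2 : ((p ^ (k₁ + 2 * k₂) : ℕ) : ℤ) ∣ 2 * α ↔ (p : ℤ) ^ (k₁ + 2 * k₂) ∣ α := by
    push_cast
    have : IsCoprime ((p : ℤ) ^ (k₁ + 2 * k₂)) 2 := by
      apply IsCoprime.pow_left
      exact_mod_cast Nat.isCoprime_iff_coprime.2 (Nat.coprime_two_right.2 hodd)
    exact ⟨this.dvd_of_dvd_mul_left, fun h => Dvd.dvd.mul_left h 2⟩
  simp only [h2]
  by_cases ha : (p : ℤ) ^ (k₁ + 2 * k₂) ∣ α <;> by_cases hb : Even k₁ <;> simp [ha, hb, mul_comm]
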